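/- arXiv:1108.2207 — 2 statements merged into one kernel-verified Lean document; each statement's English description precedes it below -/
import Mathlib

section
/- Let n ≥ 2 and let ζ ∈ ℂ be a primitive n-th root of unity, and let R_n = {p ∈ ℂ[z, z̄, w, w̄] : g_ζ(p) = p} be the invariant subalgebra. Then R_n cannot be generated as a ℂ-algebra by fewer than 2n + 6 elements: every finite set S of polynomials with Algebra.adjoin ℂ S = R_n has cardinality at least 2n + 6 (so the algebraic embedding dimension of the quotient V/ℤ_n is exactly 2n + 6). -/
open MvPolynomial

/-- The ℂ-algebra endomorphism of ℂ[z, z̄, w, w̄] determined by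
`z ↦ ζz, z̄ ↦ ζ⁻¹z̄, w ↦ ζw, w̄ ↦ ζ⁻¹w̄` (variables indexed `0 ↦ z, 1 ↦ z̄, 2 ↦ w, 3 ↦ w̄`). -/
noncomputable def gAut (ζ : ℂ) : MvPolynomial (Fin 4) ℂ →ₐ[ℂ] MvPolynomial (Fin 4) ℂ :=
  aeval ![C ζ * X 0, C ζ⁻¹ * X 1, C ζ * X 2, C ζ⁻¹ * X 3]

/-- If the exponents occurring in elements of `adjoin S` lie in `M`, and `adjoin S` contains the
monomials attached to a family of distinct nonzero exponents that do not decompose in `M`,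
then `S` has at least as many elements as the family. -/
theorem MvPolynomial.card_le_of_indecomposable_exponents {σ K ι : Type*} [Field K] [Fintype ι]
    (S : Finset (MvPolynomial σ K)) (M : Set (σ →₀ ℕ)) (e : ι → σ →₀ ℕ)
    (he : Function.Injective e) (he0 : ∀ t, e t ≠ 0)
    (hM : ∀ p ∈ Algebra.adjoin K (S : Set (MvPolynomial σ K)), ∀ a, coeff a p ≠ 0 → a ∈ M)
    (hmem : ∀ t, monomial (e t) 1 ∈ Algebra.adjoin K (S : Set (MvPolynomial σ K)))
    (hind : ∀ t, ∀ a ∈ M, ∀ b ∈ M, a + b = e t → a = 0 ∨ b = 0) :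
    Fintype.card ι ≤ S.card := by
  classical
  let L : MvPolynomial σ K →ₗ[K] (ι → K) := LinearMap.pi fun t => lcoeff K (e t)
  have hL : ∀ p t, L p t = coeff (e t) p := fun _ _ => rfl
  have hmul : ∀ p ∈ Algebra.adjoin K (S : Set (MvPolynomial σ K)),
      ∀ q ∈ Algebra.adjoin K (S : Set (MvPolynomial σ K)),
      L (p * q) = coeff 0 p • L q + coeff 0 q • L p := by
    intro p hp q hq
    ext t
    simp only [hL, Pi.add_apply, Pi.smul_apply, smul_eq_mul]
    have hne : ((0 : σ →₀ ℕ), e t) ≠ (e t, 0) := fun h => he0 t (congrArg Prod.snd h)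
    rw [coeff_mul, ← Finset.sum_subset
      (s₁ := {((0 : σ →₀ ℕ), e t), (e t, (0 : σ →₀ ℕ))}), Finset.sum_pair hne]
    · ring
    · intro x hx
      simp only [Finset.mem_insert, Finset.mem_singleton] at hx
      rcases hx with rfl | rfl <;> simp
    · rintro ⟨a, b⟩ hab hnot
      rw [Finset.HasAntidiagonal.mem_antidiagonal] at hab
      by_contra hprod
      obtain ⟨ha, hb⟩ := mul_ne_zero_iff.mp hprod
      apply hnot
      simp only at hab
      rcases hind t a (hM p hp a ha) b (hM q hq b hb) hab with rfl | rfl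
      · simp [← hab]
      · simp [← hab]
  have hspan : ∀ p ∈ Algebra.adjoin K (S : Set (MvPolynomial σ K)),
      L p ∈ Submodule.span K ((S.image L : Finset (ι → K)) : Set (ι → K)) := by
    intro p hp
    induction hp using Algebra.adjoin_induction with
    | mem x hx => exact Submodule.subset_span (Finset.mem_coe.mpr (Finset.mem_image_of_mem L hx))
    | algebraMap r =>
      have : L (algebraMap K _ r) = 0 := by
        ext t
        simp [hL, algebraMap_eq, coeff_C, (he0 t).symm]
      rw [this]
      exact Submodule.zero_mem _
    | add x y _ _ hx hy => rw [map_add]; exact Submodule.add_mem _ hx hy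
    | mul x y hx' hy' hx hy =>
      rw [hmul x hx' y hy']
      exact Submodule.add_mem _ (Submodule.smul_mem _ _ hy) (Submodule.smul_mem _ _ hx)
  have htop : Submodule.span K ((S.image L : Finset (ι → K)) : Set (ι → K)) = ⊤ := by
    rw [eq_top_iff, ← (Pi.basisFun K ι).span_eq, Submodule.span_le]
    rintro _ ⟨t, rfl⟩
    have : L (monomial (e t) 1) = Pi.basisFun K ι t := by
      ext s
      simp [hL, coeff_monomial, Pi.single_apply, he.eq_iff, eq_comm]
    rw [← this]
    exact hspan _ (hmem t)
  calc Fintype.card ι = Module.finrank K (ι → K) := (Module.finrank_fintype_fun_eq_card K).symm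
    _ = Module.finrank K (Submodule.span K ((S.image L : Finset (ι → K)) : Set (ι → K))) := by
      rw [htop, finrank_top]
    _ ≤ (S.image L).card := finrank_span_finset_le_card _
    _ ≤ S.card := Finset.card_image_le

/-- The weight of an exponent under the circle action underlying `gAut`. -/
def gWeight (a : Fin 4 →₀ ℕ) : ℤ := a 0 - a 1 + a 2 - a 3

theorem gAut_monomial {ζ : ℂ} (hζ : ζ ≠ 0) (a : Fin 4 →₀ ℕ) (c : ℂ) :
    gAut ζ (monomial a c) = monomial a (ζ ^ gWeight a * c) := by
  rw [gAut, aeval_monomial, monomial_eq, Finsupp.prod_fintype _ _ (by simp),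
    Finsupp.prod_fintype _ _ (by simp)]
  simp only [Fin.prod_univ_four, gWeight, algebraMap_eq, Matrix.cons_val, mul_pow, ← C_pow, C_mul,
    zpow_sub₀ hζ, zpow_add₀ hζ, zpow_natCast, div_eq_mul_inv, inv_pow]
  ring

theorem coeff_gAut {ζ : ℂ} (hζ : ζ ≠ 0) (a : Fin 4 →₀ ℕ) (p : MvPolynomial (Fin 4) ℂ) :
    coeff a (gAut ζ p) = ζ ^ gWeight a * coeff a p := by
  induction p using MvPolynomial.induction_on' with
  | monomial b c =>
    rw [gAut_monomial hζ, coeff_monomial, coeff_monomial]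
    split_ifs with h
    · rw [h]
    · simp
  | add p q hp hq => rw [map_add, coeff_add, coeff_add, hp, hq, mul_add]

/-- Exponents of the standard generators of the invariants: the four products of one holomorphic
and one antiholomorphic variable, then `z^k w^(n-k)`, then `z̄^k w̄^(n-k)`. -/
noncomputable def generatorExponent (n : ℕ) :
    (Fin 2 × Fin 2) ⊕ (Fin (n + 1) ⊕ Fin (n + 1)) → Fin 4 →₀ ℕ
  | .inl (i, j) => Finsupp.equivFunOnFinite.symm ![1 - i, 1 - j, i, j]
  | .inr (.inl k) => Finsupp.equivFunOnFinite.symm ![k, 0, n - k, 0]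
  | .inr (.inr k) => Finsupp.equivFunOnFinite.symm ![0, k, 0, n - k]

theorem exponent_ext_iff (a b : Fin 4 →₀ ℕ) :
    a = b ↔ a 0 = b 0 ∧ a 1 = b 1 ∧ a 2 = b 2 ∧ a 3 = b 3 := by
  simp [Finsupp.ext_iff, Fin.forall_fin_succ]

theorem generatorExponent_injective {n : ℕ} (hn : 2 ≤ n) :
    Function.Injective (generatorExponent n) := by
  rintro (⟨i, j⟩ | k | k) (⟨i', j'⟩ | k' | k') h <;>
    simp only [exponent_ext_iff, generatorExponent, Finsupp.coe_equivFunOnFinite_symm,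
      Matrix.cons_val] at h <;>
    simp only [Sum.inl.injEq, Sum.inr.injEq, Prod.mk.injEq, Fin.ext_iff, reduceCtorEq] <;>
    omega

theorem generatorExponent_ne_zero {n : ℕ} (hn : 2 ≤ n) (t) : generatorExponent n t ≠ 0 := by
  intro h
  rcases t with (⟨i, j⟩ | k | k) <;>
    simp only [exponent_ext_iff, generatorExponent, Finsupp.coe_equivFunOnFinite_symm,
      Matrix.cons_val, Finsupp.coe_zero, Pi.zero_apply] at h <;>
    omega

theorem dvd_gWeight_generatorExponent (n : ℕ) (t) :
    (n : ℤ) ∣ gWeight (generatorExponent n t) := by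
  rcases t with (⟨i, j⟩ | k | k) <;>
    simp only [gWeight, generatorExponent, Finsupp.coe_equivFunOnFinite_symm, Matrix.cons_val]
  · exact ⟨0, by omega⟩
  · exact ⟨1, by omega⟩
  · exact ⟨-1, by omega⟩

theorem generatorExponent_indecomposable {n : ℕ} (hn : 2 ≤ n) (t) (a b : Fin 4 →₀ ℕ)
    (ha : (n : ℤ) ∣ gWeight a) (hab : a + b = generatorExponent n t) : a = 0 ∨ b = 0 := by
  have hcases : gWeight a = 0 ∨ (n : ℤ) ≤ |gWeight a| := by
    by_cases h : gWeight a = 0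
    · exact .inl h
    · exact .inr (Int.le_of_dvd (abs_pos.mpr h) ((dvd_abs _ _).mpr ha))
  rw [le_abs] at hcases
  rcases t with (⟨i, j⟩ | k | k) <;>
    simp only [exponent_ext_iff, generatorExponent, Finsupp.coe_equivFunOnFinite_symm, gWeight,
      Matrix.cons_val, Finsupp.coe_zero, Pi.zero_apply, Finsupp.coe_add, Pi.add_apply]
      at hab hcases ⊢ <;>
    omega

/-- The invariant algebra `R_n` of the ℤ/n-action cannot be generated by fewer than `2n + 6`
elements: its algebraic embedding dimension is exactly `2n + 6`. -/
theorem invariants_embedding_dimension (n : ℕ) (hn : 2 ≤ n) (ζ : ℂ)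
    (hζ : IsPrimitiveRoot ζ n)
    (S : Finset (MvPolynomial (Fin 4) ℂ))
    (hS : Algebra.adjoin ℂ (S : Set (MvPolynomial (Fin 4) ℂ)) =
      AlgHom.equalizer (gAut ζ) (AlgHom.id ℂ (MvPolynomial (Fin 4) ℂ))) :
    2 * n + 6 ≤ S.card := by
  have hζ0 : ζ ≠ 0 := hζ.ne_zero (by omega)
  have hcard := MvPolynomial.card_le_of_indecomposable_exponents S
    {a | (n : ℤ) ∣ gWeight a} (generatorExponent n) (generatorExponent_injective hn)
    (generatorExponent_ne_zero hn) ?_ ?_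
    (fun t a ha b _ hab => generatorExponent_indecomposable hn t a b ha hab)
  · simp only [Fintype.card_sum, Fintype.card_prod, Fintype.card_fin] at hcard
    omega
  · intro p hp a ha
    rw [hS, AlgHom.mem_equalizer, AlgHom.id_apply] at hp
    have h := coeff_gAut hζ0 a p
    rw [hp] at h
    exact (hζ.zpow_eq_one_iff_dvd _).mp ((right_eq_mul₀ ha).mp h)
  · intro t
    rw [hS, AlgHom.mem_equalizer, AlgHom.id_apply, gAut_monomial hζ0,
      (hζ.zpow_eq_one_iff_dvd _).mpr (dvd_gWeight_generatorExponent n t), one_mul]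
end

section
/- Fix an integer n ≥ 1 and set ε := (−1)ⁿ. On ℂ[u, v, w] define the bracket with structure functions {u, v} = −4n·w, {u, w} = −4n·u·v, {v, w} = 2n·v² − 8n(n+1)·ε·uⁿ, i.e. {f, g} := (−4n·w)(f_u g_v − f_v g_u) + (−4n·u·v)(f_u g_w − f_w g_u) + (2n·v² − 8n(n+1)·ε·uⁿ)(f_v g_w − f_w g_v). Then: (a) this bracket satisfies the Jacobi identity; and (b) the ℂ-algebra homomorphism F : ℂ[u, v, w] → ℂ[x, y] determined by u ↦ x²y², v ↦ x^{2n} + ε·y^{2n}, w ↦ x^{2n+1}·y − ε·x·y^{2n+1} intertwines brackets: F({f, g}) = {F f, F g}_std. (This realizes the D-series Kleinian singularity ℂ²/BD_{4n}, where BD_{4n} is the binary dihedral group, as a Poisson subvariety of ℂ³.) -/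
open MvPolynomial

/-- The bracket on ℂ[u, v, w] with structure functions `{u,v} = −4n w`, `{u,w} = −4n u v`,
`{v,w} = 2n v² − 8n(n+1) ε uⁿ`, where `ε = (−1)ⁿ` (variables `0 ↦ u, 1 ↦ v, 2 ↦ w`). -/
noncomputable def dnBr (n : ℕ) (f g : MvPolynomial (Fin 3) ℂ) : MvPolynomial (Fin 3) ℂ :=
  (C (-(4 * (n : ℂ))) * X 2) * (pderiv 0 f * pderiv 1 g - pderiv 1 f * pderiv 0 g) +
  (C (-(4 * (n : ℂ))) * X 0 * X 1) * (pderiv 0 f * pderiv 2 g - pderiv 2 f * pderiv 0 g) +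
  (C (2 * (n : ℂ)) * X 1 ^ 2 - C (8 * (n : ℂ) * ((n : ℂ) + 1) * (-1 : ℂ) ^ n) * X 0 ^ n) *
    (pderiv 1 f * pderiv 2 g - pderiv 2 f * pderiv 1 g)

/-- The standard symplectic bracket `{p, q} = p_x q_y − p_y q_x` on ℂ[x, y]. -/
noncomputable def stdBr (p q : MvPolynomial (Fin 2) ℂ) : MvPolynomial (Fin 2) ℂ :=
  pderiv 0 p * pderiv 1 q - pderiv 1 p * pderiv 0 q

/-- The Hilbert-map pullback `u ↦ x²y², v ↦ x^{2n} + ε y^{2n}, w ↦ x^{2n+1}y − ε x y^{2n+1}`,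
with `ε = (−1)ⁿ`. -/
noncomputable def dnHilbert (n : ℕ) : MvPolynomial (Fin 3) ℂ →ₐ[ℂ] MvPolynomial (Fin 2) ℂ :=
  aeval ![X 0 ^ 2 * X 1 ^ 2,
    X 0 ^ (2 * n) + C ((-1 : ℂ) ^ n) * X 1 ^ (2 * n),
    X 0 ^ (2 * n + 1) * X 1 - C ((-1 : ℂ) ^ n) * X 0 * X 1 ^ (2 * n + 1)]

/-- A bracket on a commutative ring built from commuting derivations satisfies the Jacobi identity
as soon as its vector of structure functions `(c, -b, a)` is curl-free. -/
lemma jacobi_of_curl_free {R A : Type*} [CommRing R] [CommRing A] [Algebra R A]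
    (D₀ D₁ D₂ : Derivation R A A) (h₀₁ : ∀ p, D₁ (D₀ p) = D₀ (D₁ p))
    (h₀₂ : ∀ p, D₂ (D₀ p) = D₀ (D₂ p)) (h₁₂ : ∀ p, D₂ (D₁ p) = D₁ (D₂ p))
    (a b c : A) (hcb : D₁ c = -D₀ b) (hca : D₂ c = D₀ a) (hab : D₁ a = -D₂ b)
    (B : A → A → A) (hB : ∀ p q, B p q = a * (D₀ p * D₁ q - D₁ p * D₀ q) +
      b * (D₀ p * D₂ q - D₂ p * D₀ q) + c * (D₁ p * D₂ q - D₂ p * D₁ q)) (f g h : A) :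
    B f (B g h) + B g (B h f) + B h (B f g) = 0 := by
  simp only [hB, map_add, map_sub, Derivation.leibniz, smul_eq_mul, h₀₁, h₀₂, h₁₂, hcb, hca, hab]
  ring

lemma pderiv_pderiv_comm {R σ : Type*} [CommRing R] (i j : σ) (p : MvPolynomial σ R) :
    pderiv i (pderiv j p) = pderiv j (pderiv i p) := by
  classical
  have h : ⁅pderiv (R := R) i, pderiv (R := R) j⁆ = 0 := by
    ext k
    simp [Derivation.commutator_apply, pderiv_X, Pi.single_apply, apply_ite]
  have := DFunLike.congr_fun h p
  rwa [Derivation.commutator_apply, Derivation.zero_apply, sub_eq_zero] at this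

/-- Chain rule for partial derivatives of a polynomial substitution. -/
lemma pderiv_aeval {R σ τ : Type*} [CommRing R] [Fintype σ] (φ : σ → MvPolynomial τ R) (i : τ)
    (p : MvPolynomial σ R) :
    pderiv i (aeval φ p) = ∑ j, aeval φ (pderiv j p) * pderiv i (φ j) := by
  classical
  induction p using MvPolynomial.induction_on with
  | C r => simp [← algebraMap_eq]
  | add p q hp hq => simp only [map_add, hp, hq, add_mul, Finset.sum_add_distrib]
  | mul_X p k hp =>
    simp only [map_mul, aeval_X, Derivation.leibniz, smul_eq_mul, hp, map_add, add_mul,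
      Finset.sum_add_distrib, pderiv_X, Finset.mul_sum]
    congr 1
    · rw [Finset.sum_eq_single k]
      · simp
      · intro j _ hj
        simp [hj.symm]
      · simp
    · exact Finset.sum_congr rfl fun j _ => by ring

/-- The standard bracket of two substituted polynomials, in terms of its values on the
substituted variables. -/
lemma stdBr_aeval (φ : Fin 3 → MvPolynomial (Fin 2) ℂ) (f g : MvPolynomial (Fin 3) ℂ) :
    stdBr (aeval φ f) (aeval φ g) =
      stdBr (φ 0) (φ 1) * aeval φ (pderiv 0 f * pderiv 1 g - pderiv 1 f * pderiv 0 g) +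
      stdBr (φ 0) (φ 2) * aeval φ (pderiv 0 f * pderiv 2 g - pderiv 2 f * pderiv 0 g) +
      stdBr (φ 1) (φ 2) * aeval φ (pderiv 1 f * pderiv 2 g - pderiv 2 f * pderiv 1 g) := by
  simp only [stdBr, pderiv_aeval, Fin.sum_univ_three, map_sub, map_mul]
  ring

lemma stdBr_hilbert_u_v (n : ℕ) (hn : 1 ≤ n) (e : ℂ) :
    stdBr (X 0 ^ 2 * X 1 ^ 2) (X 0 ^ (2 * n) + C e * X 1 ^ (2 * n)) =
      -(4 * (n : MvPolynomial (Fin 2) ℂ)) *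
        (X 0 ^ (2 * n + 1) * X 1 - C e * X 0 * X 1 ^ (2 * n + 1)) := by
  obtain ⟨m, rfl⟩ : ∃ m, n = m + 1 := ⟨n - 1, by omega⟩
  simp [stdBr, Derivation.leibniz, Derivation.leibniz_pow, pderiv_X,
    show 2 * (m + 1) - 1 = 2 * m + 1 by omega]
  ring

lemma stdBr_hilbert_u_w (n : ℕ) (e : ℂ) :
    stdBr (X 0 ^ 2 * X 1 ^ 2) (X 0 ^ (2 * n + 1) * X 1 - C e * X 0 * X 1 ^ (2 * n + 1)) =
      -(4 * (n : MvPolynomial (Fin 2) ℂ)) * (X 0 ^ 2 * X 1 ^ 2) *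
        (X 0 ^ (2 * n) + C e * X 1 ^ (2 * n)) := by
  simp [stdBr, Derivation.leibniz, Derivation.leibniz_pow, pderiv_X]
  ring

lemma stdBr_hilbert_v_w (n : ℕ) (hn : 1 ≤ n) (e : ℂ) :
    stdBr (X 0 ^ (2 * n) + C e * X 1 ^ (2 * n))
        (X 0 ^ (2 * n + 1) * X 1 - C e * X 0 * X 1 ^ (2 * n + 1)) =
      2 * (n : MvPolynomial (Fin 2) ℂ) * (X 0 ^ (2 * n) + C e * X 1 ^ (2 * n)) ^ 2 -
        8 * (n : MvPolynomial (Fin 2) ℂ) * ((n : MvPolynomial (Fin 2) ℂ) + 1) * C e *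
          (X 0 ^ 2 * X 1 ^ 2) ^ n := by
  obtain ⟨m, rfl⟩ : ∃ m, n = m + 1 := ⟨n - 1, by omega⟩
  simp [stdBr, Derivation.leibniz, Derivation.leibniz_pow, pderiv_X,
    show 2 * (m + 1) - 1 = 2 * m + 1 by omega]
  ring

/-- (a) The bracket `dnBr n` satisfies the Jacobi identity, and (b) the Hilbert map
intertwines it with the standard symplectic bracket: this realizes the D-series Kleinian
singularity ℂ²/BD_{4n} as a Poisson subvariety of ℂ³. -/
theorem Dn_singularity_poisson_embedding (n : ℕ) (hn : 1 ≤ n) :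
    (∀ f g h : MvPolynomial (Fin 3) ℂ,
      dnBr n f (dnBr n g h) + dnBr n g (dnBr n h f) + dnBr n h (dnBr n f g) = 0) ∧
    (∀ f g : MvPolynomial (Fin 3) ℂ,
      dnHilbert n (dnBr n f g) = stdBr (dnHilbert n f) (dnHilbert n g)) := by
  constructor
  · refine jacobi_of_curl_free (pderiv 0) (pderiv 1) (pderiv 2) (pderiv_pderiv_comm 1 0)
      (pderiv_pderiv_comm 2 0) (pderiv_pderiv_comm 2 1) _ _ _ ?_ ?_ ?_ (dnBr n) fun _ _ => rfl
    · simp [Derivation.leibniz, Derivation.leibniz_pow, pderiv_X]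
      simp only [map_ofNat]
      ring
    · simp [Derivation.leibniz, Derivation.leibniz_pow, pderiv_X]
    · simp [Derivation.leibniz, pderiv_X]
  · intro f g
    rw [dnHilbert, stdBr_aeval]
    simp only [Matrix.cons_val]
    rw [stdBr_hilbert_u_v n hn, stdBr_hilbert_u_w n, stdBr_hilbert_v_w n hn, dnBr]
    simp only [map_add, map_sub, map_mul, map_neg, map_pow (aeval _), aeval_X, aeval_C,
      algebraMap_eq, Matrix.cons_val, map_natCast, map_ofNat, map_one]
end
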